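/- arXiv:1001.4187 — 2 statements merged into one kernel-verified Lean document; each statement's English description precedes it below -/
import Mathlib

section
/- Let 𝔞 be a nonzero fractional ideal of O_K and let E(𝔞) be the set of minima of 𝔞. The unit group O_K^* acts on E(𝔞) by multiplication, and the map E(𝔞)/O_K^* → Id(K), μ·O_K^* ↦ (1/μ)·𝔞, is a well-defined bijection between the set of O_K^*-orbits of minima of 𝔞 and the set of reduced fractional ideals equivalent to 𝔞 (i.e. reduced fractional ideals of the form f·𝔞 with f ∈ K^*). Equivalently: (i) for minima μ, μ' of 𝔞, one has (1/μ)·𝔞 = (1/μ')·𝔞 if and only if μ'/μ ∈ O_K^*; (ii) for every minimum μ of 𝔞 the fractional ideal (1/μ)·𝔞 is reduced; (iii) every reduced fractional ideal of the form f·𝔞 with f ∈ K^* equals (1/μ)·𝔞 for some minimum μ of 𝔞. -/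
open NumberField nonZeroDivisors

/-- `μ` is a *minimum* of the nonzero fractional ideal `a` of `O_K` if `μ ∈ a`, `μ ≠ 0`,
and every nonzero `f ∈ a` with `w(f) ≤ w(μ)` for all infinite places `w` satisfies
`w(f) = w(μ)` for some infinite place `w`. -/
def IsMinimum {K : Type*} [Field K] [NumberField K]
    (a : FractionalIdeal (𝓞 K)⁰ K) (μ : K) : Prop :=
  μ ∈ a ∧ μ ≠ 0 ∧
    ∀ f ∈ a, f ≠ (0 : K) → (∀ w : InfinitePlace K, w f ≤ w μ) →
      ∃ w : InfinitePlace K, w f = w μ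

/-- A nonzero fractional ideal `b` of `O_K` is *reduced* if `1 ∈ b` and `1` is a minimum
of `b`. -/
def IsReducedIdeal {K : Type*} [Field K] [NumberField K]
    (b : FractionalIdeal (𝓞 K)⁰ K) : Prop :=
  (1 : K) ∈ b ∧ IsMinimum b 1

/-- Scaling by `c ≠ 0` carries minima of `a` to minima of `c·a`. -/
theorem IsMinimum.spanSingleton_mul {K : Type*} [Field K] [NumberField K]
    {a : FractionalIdeal (𝓞 K)⁰ K} {μ c : K} (h : IsMinimum a μ) (hc : c ≠ 0) :
    IsMinimum (FractionalIdeal.spanSingleton (𝓞 K)⁰ c * a) (c * μ) := by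
  obtain ⟨hμ, hμ0, hmin⟩ := h
  refine ⟨FractionalIdeal.mem_singleton_mul.2 ⟨μ, hμ, rfl⟩, mul_ne_zero hc hμ0, ?_⟩
  intro f hf hf0 hle
  obtain ⟨g, hg, rfl⟩ := FractionalIdeal.mem_singleton_mul.1 hf
  obtain ⟨w, hw⟩ := hmin g hg (right_ne_zero_of_mul hf0) fun w => by
    have hwc : 0 < w c := InfinitePlace.pos_iff.2 hc
    have hle' := hle w
    rw [map_mul, map_mul] at hle'
    exact le_of_mul_le_mul_left hle' hwc
  exact ⟨w, by rw [map_mul, map_mul, hw]⟩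

/-- Two elements generate the same fractional ideal iff they differ by a unit. -/
theorem FractionalIdeal.spanSingleton_eq_spanSingleton_iff_units_smul
    {R K : Type*} [CommRing R] [IsDomain R] [Field K] [Algebra R K] [IsFractionRing R K]
    (x y : K) :
    FractionalIdeal.spanSingleton R⁰ x = FractionalIdeal.spanSingleton R⁰ y ↔
      ∃ u : Rˣ, u • x = y := by
  rw [← FractionalIdeal.coeToSubmodule_inj, FractionalIdeal.coe_spanSingleton,
    FractionalIdeal.coe_spanSingleton, Submodule.span_singleton_eq_span_singleton]

/-- Let `a` be a nonzero fractional ideal of `O_K` and `E(a)` its set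
of minima.  The map `E(a)/O_K^* → Id(K)`, `μ·O_K^* ↦ (1/μ)·a` is a well-defined
bijection onto the set of reduced fractional ideals equivalent to `a`.  Equivalently:
(i) for minima `μ, μ'` of `a`, `(1/μ)·a = (1/μ')·a` iff `μ'/μ ∈ O_K^*`;
(ii) for every minimum `μ` of `a`, the ideal `(1/μ)·a` is reduced;
(iii) every reduced fractional ideal of the form `f·a` with `f ∈ K^*` equals `(1/μ)·a`
for some minimum `μ` of `a`. -/
theorem minima_orbits_biject_reduced_ideals
    {K : Type*} [Field K] [NumberField K]
    (a : FractionalIdeal (𝓞 K)⁰ K) (ha : a ≠ 0) :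
    (∀ μ μ' : K, IsMinimum a μ → IsMinimum a μ' →
      (FractionalIdeal.spanSingleton (𝓞 K)⁰ μ⁻¹ * a =
          FractionalIdeal.spanSingleton (𝓞 K)⁰ μ'⁻¹ * a ↔
        ∃ u : (𝓞 K)ˣ, ((u : 𝓞 K) : K) = μ' / μ)) ∧
    (∀ μ : K, IsMinimum a μ →
      IsReducedIdeal (FractionalIdeal.spanSingleton (𝓞 K)⁰ μ⁻¹ * a)) ∧
    (∀ f : K, f ≠ 0 → IsReducedIdeal (FractionalIdeal.spanSingleton (𝓞 K)⁰ f * a) →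
      ∃ μ : K, IsMinimum a μ ∧
        FractionalIdeal.spanSingleton (𝓞 K)⁰ f * a =
          FractionalIdeal.spanSingleton (𝓞 K)⁰ μ⁻¹ * a) := by
  refine ⟨fun μ μ' hμ hμ' => ?_, fun μ hμ => ?_, fun f hf hred => ?_⟩
  · have hμ0 := hμ.2.1
    have hμ'0 := hμ'.2.1
    rw [mul_left_inj' ha, eq_comm,
      FractionalIdeal.spanSingleton_eq_spanSingleton_iff_units_smul]
    refine exists_congr fun u => ?_
    rw [Units.smul_def, Algebra.smul_def, ← div_eq_mul_inv, div_eq_iff hμ'0,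
      eq_div_iff hμ0, inv_mul_eq_div, eq_div_iff hμ0]
  · have h := hμ.spanSingleton_mul (inv_ne_zero hμ.2.1)
    rw [inv_mul_cancel₀ hμ.2.1] at h
    exact ⟨h.1, h⟩
  · have h := hred.2.spanSingleton_mul (inv_ne_zero hf)
    rw [← mul_assoc, FractionalIdeal.spanSingleton_mul_spanSingleton, inv_mul_cancel₀ hf,
      FractionalIdeal.spanSingleton_one, one_mul, mul_one] at h
    exact ⟨f⁻¹, h, by rw [inv_inv]⟩
end

section
/- Let μ be a minimum of O_K and v ∈ ℝⁿ. Then there exists a minimum μ' of the fractional ideal (1/μ)·O_K with Ψ(μ') + Ψ(μ) = v and (1/(μ'·μ))·O_K = O_K (equivalently, μ'·μ ∈ O_K^*) if and only if v ∈ Λ_K. -/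
open NumberField nonZeroDivisors

theorem exists_unit_coe_eq_of_spanSingleton_inv_eq_one {K : Type*} [Field K] [NumberField K]
    {x : K} (h : FractionalIdeal.spanSingleton (𝓞 K)⁰ x⁻¹ = 1) :
    ∃ u : (𝓞 K)ˣ, ((u : 𝓞 K) : K) = x := by
  have hx : x⁻¹ ∈ (1 : FractionalIdeal (𝓞 K)⁰ K) := by
    rw [← h]
    exact FractionalIdeal.mem_spanSingleton_self _ _
  have h_one : (1 : K) ∈ FractionalIdeal.spanSingleton (𝓞 K)⁰ x⁻¹ := by
    rw [h]
    exact FractionalIdeal.one_mem_one _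
  obtain ⟨r, hr⟩ := (FractionalIdeal.mem_one_iff _).1 hx
  obtain ⟨s, hs⟩ := (FractionalIdeal.mem_spanSingleton _).1 h_one
  rw [Algebra.smul_def] at hs
  have hsr : s * r = 1 := by
    apply RingOfIntegers.coe_injective
    rw [map_mul, map_one, hr, hs]
  exact ⟨⟨s, r, hsr, by rw [mul_comm, hsr]⟩, by simpa using eq_inv_of_mul_eq_one_left hs⟩

theorem spanSingleton_unit_inv {K : Type*} [Field K] [NumberField K] (u : (𝓞 K)ˣ) :
    FractionalIdeal.spanSingleton (𝓞 K)⁰ ((u : 𝓞 K) : K)⁻¹ = 1 := by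
  rw [← FractionalIdeal.spanSingleton_inv, inv_eq_one,
    ← FractionalIdeal.coeIdeal_span_singleton, Ideal.span_singleton_eq_top.2 u.isUnit,
    FractionalIdeal.coeIdeal_top]

theorem isMinimum_mul_unit {K : Type*} [Field K] [NumberField K] {c : K} (hc : c ≠ 0)
    (u : (𝓞 K)ˣ) :
    IsMinimum (FractionalIdeal.spanSingleton (𝓞 K)⁰ c * 1) (c * ((u : 𝓞 K) : K)) := by
  have hu : ((u : 𝓞 K) : K) ≠ 0 := RingOfIntegers.coe_ne_zero_iff.2 u.ne_zero
  rw [mul_one]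
  refine ⟨?_, mul_ne_zero hc hu, fun f hf hf0 hle => ?_⟩
  · exact (FractionalIdeal.mem_spanSingleton _).2 ⟨u, by rw [Algebra.smul_def, mul_comm]⟩
  obtain ⟨g, rfl⟩ := (FractionalIdeal.mem_spanSingleton _).1 hf
  rw [Algebra.smul_def, mul_comm] at *
  have hg : g ≠ 0 := by
    rintro rfl
    simp at hf0
  by_contra! hne
  have hlt (w : InfinitePlace K) : w (algebraMap (𝓞 K) K (g * (u⁻¹ : (𝓞 K)ˣ))) < 1 := by
    have h := (hle w).lt_of_ne (hne w)
    rw [map_mul, map_mul] at h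
    have h' : w (algebraMap (𝓞 K) K g) < w ((u : 𝓞 K) : K) :=
      lt_of_mul_lt_mul_left h (apply_nonneg w c)
    have hinv : algebraMap (𝓞 K) K (u⁻¹ : (𝓞 K)ˣ) = ((u : 𝓞 K) : K)⁻¹ := by
      apply eq_inv_of_mul_eq_one_left
      rw [← map_mul, Units.inv_mul, map_one]
    rw [map_mul, map_mul, hinv, map_inv₀, ← div_eq_mul_inv,
      div_lt_one (InfinitePlace.pos_iff.2 hu)]
    exact h'
  obtain ⟨w⟩ := (inferInstance : Nonempty (InfinitePlace K))
  exact (InfinitePlace.one_le_of_lt_one (w := w) (mul_ne_zero hg (u⁻¹).ne_zero)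
    fun z _ => hlt z).not_gt (hlt w)

/-- Let `K` be a number field of unit rank `n`, so `K` has exactly
`n+1` infinite places `w 1, …, w (n+1)`, and let `Ψ : K^* → ℝⁿ`,
`Ψ(f) = (log w₁(f), …, log w_n(f))`, with `Λ_K = Ψ(O_K^*)` the logarithm lattice.
Let `μ` be a minimum of `O_K` and `v ∈ ℝⁿ`.  Then there is a minimum `μ'` of `(1/μ)·O_K`
with `Ψ(μ') + Ψ(μ) = v` and `(1/(μ'·μ))·O_K = O_K` if and only if `v ∈ Λ_K`. -/
theorem exists_minimum_summing_to_iff_mem_unit_lattice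
    {K : Type*} [Field K] [NumberField K] {n : ℕ}
    (e : Fin (n + 1) ≃ InfinitePlace K)
    (Ψ : K → (Fin n → ℝ))
    (hΨ : ∀ f : K, ∀ i : Fin n, Ψ f i = Real.log ((e i.castSucc) f))
    (μ : K) (hμ : IsMinimum (1 : FractionalIdeal (𝓞 K)⁰ K) μ)
    (v : Fin n → ℝ) :
    (∃ μ' : K,
        IsMinimum (FractionalIdeal.spanSingleton (𝓞 K)⁰ μ⁻¹ * 1) μ' ∧
        Ψ μ' + Ψ μ = v ∧
        FractionalIdeal.spanSingleton (𝓞 K)⁰ (μ' * μ)⁻¹ * 1 =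
          (1 : FractionalIdeal (𝓞 K)⁰ K)) ↔
      ∃ u : (𝓞 K)ˣ, Ψ ((u : 𝓞 K) : K) = v := by
  have hadd {a b : K} (ha : a ≠ 0) (hb : b ≠ 0) : Ψ a + Ψ b = Ψ (a * b) := by
    ext i
    rw [Pi.add_apply, hΨ, hΨ, hΨ, map_mul, Real.log_mul]
    · exact (InfinitePlace.pos_iff.2 ha).ne'
    · exact (InfinitePlace.pos_iff.2 hb).ne'
  have hμ0 : μ ≠ 0 := hμ.2.1
  constructor
  · rintro ⟨μ', hμ', hv, hspan⟩
    rw [mul_one] at hspan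
    obtain ⟨u, hu⟩ := exists_unit_coe_eq_of_spanSingleton_inv_eq_one hspan
    exact ⟨u, by rw [hu, ← hadd hμ'.2.1 hμ0, hv]⟩
  · rintro ⟨u, rfl⟩
    have hmin := isMinimum_mul_unit (inv_ne_zero hμ0) u
    have hmul : μ⁻¹ * ((u : 𝓞 K) : K) * μ = ((u : 𝓞 K) : K) := by
      field_simp
    refine ⟨_, hmin, ?_, ?_⟩
    · rw [hadd hmin.2.1 hμ0, hmul]
    · rw [hmul, mul_one, spanSingleton_unit_inv]
end
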